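/- arXiv:0803.1876 — 2 statements merged into one kernel-verified Lean document; each statement's English description precedes it below -/
import Mathlib

section
/- Let f : ℝ → ℝ³ be a C^∞ embedding of period L > 0 (f(s+L) = f(s) for all s) parametrized by arc length (|f'(s)| = 1 for all s), with image K = f([0,L]). Let P ∈ ℝ³ with P ∉ K and r > 0, and let I = I_{P,r} be the inversion in the sphere of center P and radius r. Then the writhe of the inverted knot satisfies Wr(I∘f) = −Wr(f). -/
noncomputable section
open Real

/-- Euclidean 3-space. -/
abbrev E3 : Type := EuclideanSpace ℝ (Fin 3)

/-- The dot product of two vectors in `E3`. -/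
def dot3 (u v : E3) : ℝ := u 0 * v 0 + u 1 * v 1 + u 2 * v 2

/-- The cross product of two vectors in `E3`. -/
def cross3 (u v : E3) : E3 :=
  (WithLp.equiv 2 (Fin 3 → ℝ)).symm
    ![u 1 * v 2 - u 2 * v 1, u 2 * v 0 - u 0 * v 2, u 0 * v 1 - u 1 * v 0]

/-- The determinant `det(u, v, w)` of three vectors in `E3`. -/
def det3 (u v w : E3) : ℝ := dot3 u (cross3 v w)

/-- The writhe of a closed curve `g` of period `L`, given by the Gauss integral. -/
def writhe (g : ℝ → E3) (L : ℝ) : ℝ :=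
  (1 / (4 * π)) * ∫ s in (0:ℝ)..L, ∫ t in (0:ℝ)..L,
    det3 (deriv g s) (deriv g t) (g s - g t) / ‖g s - g t‖ ^ 3

/-- The inversion in the sphere of center `P` and radius `r`. -/
def inv3 (P : E3) (r : ℝ) (x : E3) : E3 := P + (r ^ 2 / ‖x - P‖ ^ 2) • (x - P)

/-- The differential of the inversion `inv3 P r` at `x`, applied to `v`. -/
def dInv (P : E3) (r : ℝ) (x v : E3) : E3 :=
  (r ^ 2 / ‖x - P‖ ^ 2) • (v - ((2 * dot3 (x - P) v) / ‖x - P‖ ^ 2) • (x - P))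

/-- The total twist of a closed curve `g` of period `L` with unit normal framing `w`. -/
def twist (g w : ℝ → E3) (L : ℝ) : ℝ :=
  (1 / (2 * π)) * ∫ s in (0:ℝ)..L,
    dot3 (deriv w s) (cross3 ((‖deriv g s‖)⁻¹ • deriv g s) (w s))

/-- The principal normal `e₂ = f''/κ` of an arc-length parametrized curve. -/
def e2 (f : ℝ → E3) (s : ℝ) : E3 := (‖deriv (deriv f) s‖)⁻¹ • deriv (deriv f) s

/-- The binormal `e₃ = e₁ × e₂` of an arc-length parametrized curve. -/
def e3 (f : ℝ → E3) (s : ℝ) : E3 := cross3 (deriv f s) (e2 f s)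

/-- The torsion `τ = e₂'·e₃` of an arc-length parametrized curve. -/
def torsionArc (f : ℝ → E3) (s : ℝ) : ℝ := dot3 (deriv (e2 f) s) (e3 f s)

/-- The total torsion `Tω = (1/2π) ∫ τ` of an arc-length parametrized closed curve. -/
def totalTorsionArc (f : ℝ → E3) (L : ℝ) : ℝ :=
  (1 / (2 * π)) * ∫ s in (0:ℝ)..L, torsionArc f s

/-- The torsion `τ_g = det(g', g'', g''')/|g' × g''|²` of a regular curve. -/
def torsionGen (g : ℝ → E3) (s : ℝ) : ℝ :=
  det3 (deriv g s) (deriv (deriv g) s) (deriv (deriv (deriv g)) s) /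
    ‖cross3 (deriv g s) (deriv (deriv g) s)‖ ^ 2

/-- The total torsion `Tω = (1/2π) ∫ τ_g |g'|` of a regular closed curve. -/
def totalTorsionGen (g : ℝ → E3) (L : ℝ) : ℝ :=
  (1 / (2 * π)) * ∫ s in (0:ℝ)..L, torsionGen g s * ‖deriv g s‖

/-- The osculating circle at `s` of an arc-length parametrized curve with `κ(s) > 0`:
the circle of center `f(s) + (1/κ(s)) e₂(s)` and radius `1/κ(s)` in the plane through
`f(s)` spanned by `e₁(s)` and `e₂(s)`. -/
def osculatingCircleArc (f : ℝ → E3) (s : ℝ) : Set E3 :=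
  {y | (∃ a b : ℝ, y = f s + a • deriv f s + b • e2 f s) ∧
    ‖y - (f s + (‖deriv (deriv f) s‖)⁻¹ • e2 f s)‖ = (‖deriv (deriv f) s‖)⁻¹}

/-- The curvature tube of `f`: the union of all osculating circles. -/
def curvatureTube (f : ℝ → E3) : Set E3 := ⋃ s : ℝ, osculatingCircleArc f s

lemma det3_eq (u v w : E3) : det3 u v w =
    u 0 * (v 1 * w 2 - v 2 * w 1) + u 1 * (v 2 * w 0 - v 0 * w 2) +
      u 2 * (v 0 * w 1 - v 1 * w 0) := by
  simp [det3, dot3, cross3]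

lemma dot3_eq_inner (u v : E3) : dot3 u v = inner ℝ u v := by
  simp [dot3, PiLp.inner_apply, Fin.sum_univ_three]
  ring

lemma E3.norm_sq (u : E3) : ‖u‖ ^ 2 = u 0 ^ 2 + u 1 ^ 2 + u 2 ^ 2 := by
  simp [EuclideanSpace.norm_sq_eq, Fin.sum_univ_three]

lemma norm_cross3_le (v w : E3) : ‖cross3 v w‖ ≤ ‖v‖ * ‖w‖ := by
  refine le_of_sq_le_sq ?_ (by positivity)
  rw [mul_pow, E3.norm_sq, E3.norm_sq, E3.norm_sq]
  simp only [cross3, WithLp.equiv_symm_apply, Matrix.cons_val]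
  nlinarith [sq_nonneg (v 0 * w 0 + v 1 * w 1 + v 2 * w 2)]

lemma abs_det3_le (u v w : E3) : |det3 u v w| ≤ ‖u‖ * (‖v‖ * ‖w‖) := by
  rw [det3, dot3_eq_inner]
  exact (abs_real_inner_le_norm _ _).trans
    (mul_le_mul_of_nonneg_left (norm_cross3_le v w) (norm_nonneg u))

/-- The Gauss integrand of a pair of parameters of a curve. -/
def gaussForm (g : ℝ → E3) (s t : ℝ) : ℝ :=
  det3 (deriv g s) (deriv g t) (g s - g t) / ‖g s - g t‖ ^ 3

/-- A coefficient of a primitive of the sum of the Gauss forms of a curve and of its inversion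
in a sphere centered at the origin. -/
def gaussPrimitive (g : ℝ → E3) (s t : ℝ) : ℝ :=
  det3 (g s) (g t) (deriv g s) / (‖g s‖ * ‖g s - g t‖ * (‖g s‖ + ‖g t‖ + ‖g s - g t‖))

/-- The partial derivative of `gaussPrimitive` in the second parameter, as a function of the
two points and the two velocities. -/
def gaussPrimitiveDeriv (x y X Y : E3) : ℝ :=
  (det3 x Y X * (‖x‖ * ‖x - y‖ * (‖x‖ + ‖y‖ + ‖x - y‖)) -
    det3 x y X * (‖x‖ * (-inner ℝ (x - y) Y / ‖x - y‖) * (‖x‖ + ‖y‖ + ‖x - y‖) +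
      ‖x‖ * ‖x - y‖ * (inner ℝ y Y / ‖y‖ + -inner ℝ (x - y) Y / ‖x - y‖))) /
    (‖x‖ * ‖x - y‖ * (‖x‖ + ‖y‖ + ‖x - y‖)) ^ 2

lemma hasDerivAt_norm_of_ne_zero {g : ℝ → E3} {g' : E3} {t : ℝ} (hg : HasDerivAt g g' t)
    (h0 : g t ≠ 0) : HasDerivAt (fun t => ‖g t‖) (inner ℝ (g t) g' / ‖g t‖) t := by
  have h := (hg.norm_sq).sqrt (by positivity)
  simp only [Real.sqrt_sq (norm_nonneg _)] at h
  convert h using 1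
  field_simp

lemma hasDerivAt_gaussPrimitive {g : ℝ → E3} {s t : ℝ} (hg : DifferentiableAt ℝ g t)
    (hs : g s ≠ 0) (ht : g t ≠ 0) (hst : g s ≠ g t) :
    HasDerivAt (gaussPrimitive g s) (gaussPrimitiveDeriv (g s) (g t) (deriv g s) (deriv g t))
      t := by
  have hd : g s - g t ≠ 0 := sub_ne_zero.2 hst
  have hy := hg.hasDerivAt
  have h1 := hasDerivAt_norm_of_ne_zero hy ht
  have h2 := hasDerivAt_norm_of_ne_zero (hy.const_sub (g s)) hd
  rw [inner_neg_right] at h2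
  have hn : HasDerivAt (fun t => det3 (g s) (g t) (deriv g s))
      (det3 (g s) (deriv g t) (deriv g s)) t := by
    have h (v : E3) : det3 (g s) v (deriv g s) = inner ℝ (cross3 (deriv g s) (g s)) v := by
      rw [← dot3_eq_inner]
      simp [det3, dot3, cross3]
      ring
    simp only [h]
    simpa using (hasDerivAt_const t (cross3 (deriv g s) (g s))).inner ℝ hy
  have hD := (h2.const_mul ‖g s‖).mul ((h1.const_add ‖g s‖).add h2)
  exact hn.div hD (by positivity)

lemma gauss_add_inversion_aux {ρ σ c a b p q α β γ δ m : ℝ} (hρ : 0 < ρ) (hσ : 0 < σ)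
    (hc : 0 < c) (hm : c ^ 2 = ρ ^ 2 + σ ^ 2 - 2 * m)
    (h₁ : b * α - a * γ + q * ρ ^ 2 - p * m = 0) (h₂ : b * β - a * δ + q * m - p * σ ^ 2 = 0) :
    (p - q) / c ^ 3 +
      ρ * σ / c ^ 3 *
        (p / ρ ^ 2 - q / σ ^ 2 + 2 * δ * a / (ρ ^ 2 * σ ^ 2) - 2 * α * b / (ρ ^ 2 * σ ^ 2)) =
    -2 * (((-p) * (ρ * c * (ρ + σ + c)) -
        a * (ρ * (-(γ - δ) / c) * (ρ + σ + c) + ρ * c * (δ / σ + -(γ - δ) / c))) /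
        (ρ * c * (ρ + σ + c)) ^ 2 +
      (q * (σ * c * (σ + ρ + c)) -
        (-b) * (σ * (-(β - α) / c) * (σ + ρ + c) + σ * c * (α / ρ + -(β - α) / c))) /
        (σ * c * (σ + ρ + c)) ^ 2) := by
  have hS : 0 < ρ + σ + c := by positivity
  obtain rfl : m = (ρ ^ 2 + σ ^ 2 - c ^ 2) / 2 := by linarith
  rw [add_comm σ ρ]
  rw [← sub_eq_zero]
  trans (-2 * (ρ + σ + c + c) / (ρ * c ^ 3 * (ρ + σ + c) ^ 2)) *
        (b * α - a * γ + q * ρ ^ 2 - p * ((ρ ^ 2 + σ ^ 2 - c ^ 2) / 2)) +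
      (-2 * (ρ + σ + c + c) / (σ * c ^ 3 * (ρ + σ + c) ^ 2)) *
        (b * β - a * δ + q * ((ρ ^ 2 + σ ^ 2 - c ^ 2) / 2) - p * σ ^ 2)
  · field_simp
    ring
  · rw [h₁, h₂]
    simp

lemma det3_inversion_aux (x y X Y : E3) (k l u v : ℝ) :
    det3 (k • (X - u • x)) (l • (Y - v • y)) (k • x - l • y) =
      k * l * (k * det3 x X Y - l * det3 X Y y + k * v * det3 x y X - l * u * det3 x y Y) := by
  simp only [det3_eq, PiLp.sub_apply, PiLp.smul_apply, smul_eq_mul]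
  ring

lemma det3_inner_relation (x y X Y z : E3) :
    det3 x y Y * inner ℝ z X - det3 x y X * inner ℝ z Y + det3 X Y y * inner ℝ z x -
      det3 x X Y * inner ℝ z y = 0 := by
  simp only [det3_eq, ← dot3_eq_inner, dot3]
  ring

/-- The sum of the Gauss integrand and of its transform under inversion is a divergence. -/
lemma gauss_add_inversion {x y X Y : E3} (hx : x ≠ 0) (hy : y ≠ 0) (hxy : x ≠ y) :
    det3 X Y (x - y) / ‖x - y‖ ^ 3 +
      ‖x‖ * ‖y‖ / ‖x - y‖ ^ 3 *
        (det3 x X Y / ‖x‖ ^ 2 - det3 X Y y / ‖y‖ ^ 2 +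
          2 * inner ℝ y Y * det3 x y X / (‖x‖ ^ 2 * ‖y‖ ^ 2) -
          2 * inner ℝ x X * det3 x y Y / (‖x‖ ^ 2 * ‖y‖ ^ 2)) =
    -2 * (gaussPrimitiveDeriv x y X Y + gaussPrimitiveDeriv y x Y X) := by
  have hm : ‖x - y‖ ^ 2 = ‖x‖ ^ 2 + ‖y‖ ^ 2 - 2 * inner ℝ x y := by
    rw [norm_sub_sq_real]
    ring
  have h₁ := det3_inner_relation x y X Y x
  have h₂ := det3_inner_relation x y X Y y
  rw [real_inner_self_eq_norm_sq] at h₁ h₂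
  rw [real_inner_comm x y] at h₂
  have h := gauss_add_inversion_aux (norm_pos_iff.2 hx) (norm_pos_iff.2 hy)
    (norm_pos_iff.2 (sub_ne_zero.2 hxy)) hm h₁ h₂
  have e₁ : det3 X Y (x - y) = det3 x X Y - det3 X Y y := by
    simp only [det3_eq, PiLp.sub_apply]
    ring
  have e₂ : det3 x Y X = -det3 x X Y := by simp only [det3_eq]; ring
  have e₃ : det3 y X Y = det3 X Y y := by simp only [det3_eq]; ring
  have e₄ : det3 y x Y = -det3 x y Y := by simp only [det3_eq]; ring
  rw [gaussPrimitiveDeriv, gaussPrimitiveDeriv, e₁, e₂, e₃, e₄, norm_sub_rev y x,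
    inner_sub_left, inner_sub_left]
  exact h

open EuclideanGeometry in
lemma hasDerivAt_inversion_comp {g : ℝ → E3} {s r : ℝ} (hg : DifferentiableAt ℝ g s)
    (h0 : g s ≠ 0) :
    HasDerivAt (fun s => inversion 0 r (g s))
      ((r / ‖g s‖) ^ 2 • (deriv g s - (2 * inner ℝ (g s) (deriv g s) / ‖g s‖ ^ 2) • g s)) s := by
  have h := (hasFDerivAt_inversion (R := r) h0).comp_hasDerivAt s hg.hasDerivAt
  refine h.congr_deriv ?_
  change (r / dist (g s) 0) ^ 2 • (ℝ ∙ (g s - 0))ᗮ.reflection (deriv g s) = _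
  rw [Submodule.reflection_orthogonal_apply, sub_zero, dist_zero_right,
    Submodule.reflection_singleton_apply]
  simp only [RCLike.ofReal_real_eq_id, id_eq]
  module

open EuclideanGeometry in
lemma deriv_inversion_comp_ne_zero {g : ℝ → E3} {s r : ℝ} (hr : r ≠ 0)
    (hg : DifferentiableAt ℝ g s) (h0 : g s ≠ 0) (hg' : deriv g s ≠ 0) :
    deriv (fun s => inversion 0 r (g s)) s ≠ 0 := by
  have h := (hasFDerivAt_inversion (R := r) h0).comp_hasDerivAt s hg.hasDerivAt
  have hrs : r / ‖g s‖ ≠ 0 := div_ne_zero hr (norm_ne_zero_iff.2 h0)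
  have e : deriv (fun s => inversion 0 r (g s)) s = _ := h.deriv
  rw [e]
  simp [hr, h0, hg']

open EuclideanGeometry in
lemma gaussForm_inversion {g : ℝ → E3} {s t r : ℝ} (hr : r ≠ 0)
    (hs' : DifferentiableAt ℝ g s) (ht' : DifferentiableAt ℝ g t)
    (hs : g s ≠ 0) (ht : g t ≠ 0) (hst : g s ≠ g t) :
    gaussForm g s t + gaussForm (fun s => inversion 0 r (g s)) s t =
      -2 * (gaussPrimitiveDeriv (g s) (g t) (deriv g s) (deriv g t) +
        gaussPrimitiveDeriv (g t) (g s) (deriv g t) (deriv g s)) := by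
  rw [← gauss_add_inversion hs ht hst, gaussForm, gaussForm,
    (hasDerivAt_inversion_comp hs' hs).deriv, (hasDerivAt_inversion_comp ht' ht).deriv,
    ← dist_eq_norm (inversion 0 r (g s)), dist_inversion_inversion hs ht]
  have e (x : E3) : inversion 0 r x = (r / ‖x‖) ^ 2 • x := by simp [inversion]
  have h₁ := norm_pos_iff.2 hs
  have h₂ := norm_pos_iff.2 ht
  have h₃ := norm_pos_iff.2 (sub_ne_zero.2 hst)
  rw [e, e, det3_inversion_aux, dist_zero_right, dist_zero_right, dist_eq_norm]
  congr 1
  field_simp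

open Asymptotics Filter Topology in
lemma sub_isBigO_of_deriv_ne_zero {g : ℝ → E3} {s : ℝ} (hg : ContDiff ℝ 1 g)
    (h0 : deriv g s ≠ 0) :
    (fun p : ℝ × ℝ => p.1 - p.2) =O[𝓝 (s, s)] fun p => ‖g p.1 - g p.2‖ := by
  have h := (hg.hasStrictDerivAt one_ne_zero (x := s)).hasStrictFDerivAt.isLittleO
  have hb : (fun p : ℝ × ℝ => p.1 - p.2) =O[𝓝 (s, s)] fun p =>
      (p.1 - p.2) • deriv g s := by
    refine IsBigO.of_bound (‖deriv g s‖)⁻¹ (Eventually.of_forall fun p => le_of_eq ?_)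
    rw [norm_smul]
    field_simp
  have h' : (fun p : ℝ × ℝ => g p.1 - g p.2 - (p.1 - p.2) • deriv g s) =o[𝓝 (s, s)]
      fun p => (p.1 - p.2) • deriv g s := by
    refine IsLittleO.trans_isBigO ?_ hb
    simpa using h
  have h'' := h'.right_isBigO_add
  refine (hb.trans ?_).norm_right
  simpa using h''

open Asymptotics Filter Topology in
lemma sub_isBigO_sub {g : ℝ → E3} {s : ℝ} (hg : ContDiff ℝ 1 g) :
    (fun p : ℝ × ℝ => g p.1 - g p.2) =O[𝓝 (s, s)] fun p => p.1 - p.2 := by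
  exact (hg.hasStrictDerivAt one_ne_zero (x := s)).hasStrictFDerivAt.isBigO_sub

open Asymptotics Filter Topology in
lemma sub_sub_deriv_isLittleO {g : ℝ → E3} {s : ℝ} (hg : ContDiff ℝ 1 g) :
    (fun p : ℝ × ℝ => g p.1 - g p.2 - (p.1 - p.2) • deriv g s) =o[𝓝 (s, s)]
      fun p => p.1 - p.2 := by
  simpa using (hg.hasStrictDerivAt one_ne_zero (x := s)).hasStrictFDerivAt.isLittleO

open Asymptotics Filter Topology in
lemma taylor_two_isLittleO {g : ℝ → E3} {s : ℝ} (hg : ContDiff ℝ 2 g) :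
    (fun p : ℝ × ℝ => g p.1 - g p.2 - (p.1 - p.2) • deriv g p.2 -
        ((p.1 - p.2) ^ 2 / 2) • deriv (deriv g) s) =o[𝓝 (s, s)]
      fun p => (p.1 - p.2) ^ 2 := by
  have hg1 : ContDiff ℝ 1 (deriv g) := (contDiff_succ_iff_deriv.1 hg).2.2
  have hdiff : Differentiable ℝ g := hg.differentiable (by norm_num)
  refine IsLittleO.of_bound fun ε hε => ?_
  have h := (sub_sub_deriv_isLittleO (s := s) hg1).bound hε
  obtain ⟨δ, hδ, hball⟩ := Metric.eventually_nhds_iff_ball.1 h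
  refine Metric.eventually_nhds_iff_ball.2 ⟨δ, hδ, ?_⟩
  rintro ⟨a, b⟩ hab
  rw [← ball_prod_same] at hab
  obtain ⟨ha, hb⟩ := hab
  simp only at ha hb ⊢
  have hsub : Set.uIcc b a ⊆ Metric.ball s δ := by
    rw [← segment_eq_uIcc]
    exact (convex_ball s δ).segment_subset hb ha
  have hder (u : ℝ) : HasDerivAt (fun u => g u - g b - (u - b) • deriv g b -
      ((u - b) ^ 2 / 2) • deriv (deriv g) s)
      (deriv g u - deriv g b - (u - b) • deriv (deriv g) s) u := by
    have h1 : HasDerivAt (fun u : ℝ => u - b) 1 u := (hasDerivAt_id u).sub_const b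
    have h2 : HasDerivAt (fun u : ℝ => (u - b) ^ 2 / 2) (u - b) u := by
      refine ((h1.pow 2).div_const 2).congr_deriv ?_
      simp
    have h3 := (((hdiff u).hasDerivAt.sub_const (g b)).sub (h1.smul_const (deriv g b))).sub
      (h2.smul_const (deriv (deriv g) s))
    exact h3.congr_deriv (by simp)
  have hbd := (convex_uIcc b a).norm_image_sub_le_of_norm_hasDerivWithin_le
    (C := ε * |a - b|) (fun u _ => (hder u).hasDerivWithinAt) (fun u hu => ?_)
    Set.left_mem_uIcc Set.right_mem_uIcc
  · simp only [sub_self, zero_smul, ne_eq, OfNat.ofNat_ne_zero, not_false_eq_true, zero_pow,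
      zero_div, sub_zero] at hbd
    refine hbd.trans (le_of_eq ?_)
    rw [norm_pow, Real.norm_eq_abs]
    ring
  · have hub := hball (u, b) (by rw [← ball_prod_same]; exact ⟨hsub hu, hb⟩)
    refine hub.trans (mul_le_mul_of_nonneg_left ?_ hε.le)
    exact Set.abs_sub_left_of_mem_uIcc hu

open Asymptotics Filter Topology in
lemma det3_isLittleO_left {α : Type*} {l : Filter α} {u v w : α → E3} {a b c : α → ℝ}
    (hu : u =o[l] a) (hv : v =O[l] b) (hw : w =O[l] c) :
    (fun x => det3 (u x) (v x) (w x)) =o[l] fun x => a x * (b x * c x) := by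
  refine (IsBigO.of_norm_le fun x => ?_).trans_isLittleO
    (hu.norm_left.mul_isBigO (hv.norm_left.mul hw.norm_left))
  exact abs_det3_le _ _ _

open Asymptotics Filter Topology in
lemma det3_isLittleO_right {α : Type*} {l : Filter α} {u v w : α → E3} {a b c : α → ℝ}
    (hu : u =O[l] a) (hv : v =O[l] b) (hw : w =o[l] c) :
    (fun x => det3 (u x) (v x) (w x)) =o[l] fun x => a x * (b x * c x) := by
  refine (IsBigO.of_norm_le fun x => ?_).trans_isLittleO
    (hu.norm_left.mul_isLittleO (hv.norm_left.mul_isLittleO hw.norm_left))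
  exact abs_det3_le _ _ _

lemma continuous_det3 : Continuous fun p : E3 × E3 × E3 => det3 p.1 p.2.1 p.2.2 := by
  simp only [det3_eq]
  fun_prop

open Asymptotics Filter Topology in
lemma isBigO_one_of_continuous {g : ℝ × ℝ → E3} (hg : Continuous g) (p : ℝ × ℝ) :
    g =O[𝓝 p] fun _ => (1 : ℝ) :=
  hg.continuousAt.isBigO_one ℝ

open Asymptotics Filter Topology in
lemma continuousAt_gaussForm_diag {g : ℝ → E3} (hg : ContDiff ℝ 2 g) {s : ℝ}
    (h0 : deriv g s ≠ 0) : ContinuousAt (fun p : ℝ × ℝ => gaussForm g p.1 p.2) (s, s) := by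
  have hg1 : ContDiff ℝ 1 (deriv g) := (contDiff_succ_iff_deriv.1 hg).2.2
  have hg' : ContDiff ℝ 1 g := hg.of_le (by norm_num)
  have hc := hg1.continuous
  set K := deriv (deriv g) s
  have hE₁ := sub_sub_deriv_isLittleO (s := s) hg1
  have hE₂ := taylor_two_isLittleO (s := s) hg
  have hO := sub_isBigO_sub (s := s) hg1
  have hv : (fun p : ℝ × ℝ => deriv g p.2) =O[𝓝 (s, s)] fun _ => (1 : ℝ) :=
    isBigO_one_of_continuous (by fun_prop) _
  have hK : (fun p : ℝ × ℝ => ((p.1 - p.2) ^ 2 / 2) • K) =O[𝓝 (s, s)]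
      fun p => (p.1 - p.2) ^ 2 := by
    refine IsBigO.of_bound ‖K‖ (Eventually.of_forall fun p => ?_)
    rw [norm_smul, norm_div, mul_comm]
    gcongr
    rw [RCLike.norm_ofNat]
    linarith [norm_nonneg ((p.1 - p.2) ^ 2)]
  have hnum : (fun p : ℝ × ℝ => det3 (deriv g p.1) (deriv g p.2) (g p.1 - g p.2))
      =o[𝓝 (s, s)] fun p => (p.1 - p.2) ^ 3 := by
    refine ((det3_isLittleO_left hE₁ hv hK).add (det3_isLittleO_right hO hv hE₂)).congr
      (fun p => ?_) (fun p => by ring)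
    simp only [det3_eq, PiLp.sub_apply, PiLp.smul_apply, smul_eq_mul]
    ring
  have hden := (sub_isBigO_of_deriv_ne_zero hg' h0).pow 3
  have := (hnum.trans_isBigO hden).tendsto_div_nhds_zero
  rw [ContinuousAt]
  simpa [gaussForm] using this

open Asymptotics Filter Topology in
lemma continuousAt_gaussPrimitive_diag {g : ℝ → E3} (hg : ContDiff ℝ 1 g) {s : ℝ}
    (h0 : deriv g s ≠ 0) (hs : g s ≠ 0) :
    ContinuousAt (fun p : ℝ × ℝ => gaussPrimitive g p.1 p.2) (s, s) := by
  have hc := hg.continuous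
  have hc' : Continuous (deriv g) := (contDiff_one_iff_deriv.1 hg).2
  have hE := sub_sub_deriv_isLittleO (s := s) hg
  have hO := (isBigO_refl (fun p : ℝ × ℝ => p.1 - p.2) (𝓝 (s, s)))
  have hx : (fun p : ℝ × ℝ => g p.1) =O[𝓝 (s, s)] fun _ => (1 : ℝ) :=
    isBigO_one_of_continuous (by fun_prop) _
  have hX : (fun p : ℝ × ℝ => deriv g p.1) =O[𝓝 (s, s)] fun _ => (1 : ℝ) :=
    isBigO_one_of_continuous (by fun_prop) _
  have hd : (fun p : ℝ × ℝ => g p.1 - g p.2 - (p.1 - p.2) • deriv g p.1) =o[𝓝 (s, s)]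
      fun p => p.1 - p.2 := by
    have h1 : (fun p : ℝ × ℝ => (p.1 - p.2) • (deriv g p.1 - deriv g s)) =o[𝓝 (s, s)]
        fun p => (p.1 - p.2) • (1 : ℝ) := by
      refine hO.smul_isLittleO ((isLittleO_one_iff ℝ).2 ?_)
      have : ContinuousAt (fun p : ℝ × ℝ => deriv g p.1 - deriv g s) (s, s) := by fun_prop
      simpa [ContinuousAt] using this
    refine (hE.sub (h1.congr_right fun p => by simp)).congr_left fun p => ?_
    module
  have hnum : (fun p : ℝ × ℝ => det3 (g p.1) (g p.2) (deriv g p.1)) =o[𝓝 (s, s)]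
      fun p => p.1 - p.2 := by
    refine (det3_isLittleO_right hx hX hd).congr (fun p => ?_) (fun p => by ring)
    simp only [det3_eq, PiLp.sub_apply, PiLp.smul_apply, smul_eq_mul]
    ring
  have hlim := (hnum.trans_isBigO (sub_isBigO_of_deriv_ne_zero hg h0)).tendsto_div_nhds_zero
  have hrest : ContinuousAt (fun p : ℝ × ℝ =>
      (‖g p.1‖ * (‖g p.1‖ + ‖g p.2‖ + ‖g p.1 - g p.2‖))⁻¹) (s, s) := by
    refine ContinuousAt.inv₀ (by fun_prop) ?_
    simpa using hs
  have := hlim.mul hrest.tendsto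
  rw [ContinuousAt]
  rw [zero_mul] at this
  have e : gaussPrimitive g s s = 0 := by simp [gaussPrimitive]
  rw [e]
  refine this.congr fun p => ?_
  simp only [gaussPrimitive, div_eq_mul_inv, mul_inv]
  ring

lemma continuousAt_gaussForm {g : ℝ → E3} (hg : ContDiff ℝ 1 g) {s t : ℝ} (hst : g s ≠ g t) :
    ContinuousAt (fun p : ℝ × ℝ => gaussForm g p.1 p.2) (s, t) := by
  have hc := hg.continuous
  have hc' : Continuous (deriv g) := (contDiff_one_iff_deriv.1 hg).2
  have hn : Continuous fun p : ℝ × ℝ => det3 (deriv g p.1) (deriv g p.2) (g p.1 - g p.2) :=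
    continuous_det3.comp
      (f := fun p : ℝ × ℝ => (deriv g p.1, deriv g p.2, g p.1 - g p.2)) (by fun_prop)
  refine hn.continuousAt.div (by fun_prop) ?_
  simpa [sub_eq_zero] using hst

lemma differentiable_det3 : Differentiable ℝ fun p : E3 × E3 × E3 => det3 p.1 p.2.1 p.2.2 := by
  simp only [det3_eq]
  fun_prop

lemma differentiableAt_gaussPrimitive {g : ℝ → E3} (hg : ContDiff ℝ 2 g) {s t : ℝ}
    (hs : g s ≠ 0) (ht : g t ≠ 0) (hst : g s ≠ g t) :
    DifferentiableAt ℝ (fun p : ℝ × ℝ => gaussPrimitive g p.1 p.2) (s, t) := by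
  have hd : Differentiable ℝ g := hg.differentiable (by norm_num)
  have hd' : Differentiable ℝ (deriv g) :=
    ((contDiff_succ_iff_deriv (n := 1)).1 hg).2.2.differentiable (by norm_num)
  have hn : Differentiable ℝ fun p : ℝ × ℝ => det3 (g p.1) (g p.2) (deriv g p.1) :=
    differentiable_det3.comp (f := fun p : ℝ × ℝ => (g p.1, g p.2, deriv g p.1)) (by fun_prop)
  have h₀ : g s - g t ≠ 0 := sub_ne_zero.2 hst
  have h₁ : DifferentiableAt ℝ (fun p : ℝ × ℝ => ‖g p.1‖) (s, t) :=
    DifferentiableAt.norm ℝ (by fun_prop) hs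
  have h₂ : DifferentiableAt ℝ (fun p : ℝ × ℝ => ‖g p.2‖) (s, t) :=
    DifferentiableAt.norm ℝ (by fun_prop) ht
  have h₃ : DifferentiableAt ℝ (fun p : ℝ × ℝ => ‖g p.1 - g p.2‖) (s, t) :=
    DifferentiableAt.norm ℝ (by fun_prop) h₀
  have hD := ((h₁.fun_mul h₃).fun_mul ((h₁.fun_add h₂).fun_add h₃)).fun_inv
    (by simp only [ne_eq]; positivity)
  simpa only [gaussPrimitive, div_eq_mul_inv] using (hn (s, t)).fun_mul hD

section Periodic

variable {E : Type*} {g : ℝ → E} {L : ℝ}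

lemma Function.Periodic.exists_eq_add_int_mul (hg : Function.Periodic g L) (hL : 0 < L)
    (hinj : Set.InjOn g (Set.Ico 0 L)) {s t : ℝ} (hst : g s = g t) :
    ∃ k : ℤ, t = s + k * L := by
  have hmod (x : ℝ) : g (toIcoMod hL 0 x) = g x := by
    rw [← self_sub_toIcoDiv_zsmul hL 0 x, hg.sub_zsmul_eq]
  have h := hinj (toIcoMod_mem_Ico' hL s) (toIcoMod_mem_Ico' hL t) (by rw [hmod, hmod, hst])
  refine ⟨toIcoDiv hL 0 t - toIcoDiv hL 0 s, ?_⟩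
  rw [← self_sub_toIcoDiv_zsmul hL 0 s, ← self_sub_toIcoDiv_zsmul hL 0 t, zsmul_eq_mul,
    zsmul_eq_mul] at h
  push_cast
  linarith

lemma Function.Periodic.apply_ne_apply_add (hg : Function.Periodic g L) (hL : 0 < L)
    (hinj : Set.InjOn g (Set.Ico 0 L)) {s τ : ℝ} (h0 : 0 < τ) (h1 : τ < L) :
    g s ≠ g (s + τ) := by
  intro h
  obtain ⟨k, hk⟩ := hg.exists_eq_add_int_mul hL hinj h
  have hk' : τ = k * L := by linarith
  have hk0 : (0 : ℝ) < k := by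
    by_contra! hcon
    nlinarith
  have hk1 : (k : ℝ) < 1 := by
    by_contra! hcon
    nlinarith
  norm_cast at hk0 hk1
  omega

/-- Continuity of a periodic function of two parameters of a simple closed curve can be checked
at distinct points and on the diagonal. -/
lemma continuous_of_continuousAt_diag (hg : Function.Periodic g L) (hL : 0 < L)
    (hinj : Set.InjOn g (Set.Ico 0 L)) {F : ℝ → ℝ → ℝ} (hF : ∀ s, Function.Periodic (F s) L)
    (hoff : ∀ s t, g s ≠ g t → ContinuousAt (fun p : ℝ × ℝ => F p.1 p.2) (s, t))
    (hdiag : ∀ s, ContinuousAt (fun p : ℝ × ℝ => F p.1 p.2) (s, s)) :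
    Continuous fun p : ℝ × ℝ => F p.1 p.2 := by
  refine continuous_iff_continuousAt.2 fun ⟨s, t⟩ => ?_
  by_cases hst : g s = g t
  · obtain ⟨k, rfl⟩ := hg.exists_eq_add_int_mul hL hinj hst
    have hshift : ContinuousAt (fun p : ℝ × ℝ => (p.1, p.2 - k * L)) (s, s + k * L) := by
      fun_prop
    have h := ContinuousAt.comp (g := fun p : ℝ × ℝ => F p.1 p.2)
      (by simpa using hdiag s) hshift
    refine h.congr (Filter.Eventually.of_forall fun p => ?_)
    simpa using (hF p.1).sub_zsmul_eq (x := p.2) k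
  · exact hoff s t hst

end Periodic

lemma Function.Periodic.deriv_E3 {g : ℝ → E3} {L : ℝ} (hg : Function.Periodic g L) :
    Function.Periodic (deriv g) L := fun s => by
  rw [← deriv_comp_add_const, funext hg]

lemma gaussForm_periodic {g : ℝ → E3} {L : ℝ} (hg : Function.Periodic g L) (s : ℝ) :
    Function.Periodic (gaussForm g s) L := fun t => by
  rw [gaussForm, gaussForm, hg, hg.deriv_E3]

lemma gaussPrimitive_periodic {g : ℝ → E3} {L : ℝ} (hg : Function.Periodic g L) (s : ℝ) :
    Function.Periodic (gaussPrimitive g s) L := fun t => by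
  rw [gaussPrimitive, gaussPrimitive, hg]

lemma gaussPrimitive_periodic_left {g : ℝ → E3} {L : ℝ} (hg : Function.Periodic g L)
    (s t : ℝ) : gaussPrimitive g (s + L) t = gaussPrimitive g s t := by
  rw [gaussPrimitive, gaussPrimitive, hg, hg.deriv_E3]

lemma continuous_gaussForm {g : ℝ → E3} {L : ℝ} (hg : ContDiff ℝ 2 g) (hL : 0 < L)
    (hper : Function.Periodic g L) (hinj : Set.InjOn g (Set.Ico 0 L))
    (hreg : ∀ s, deriv g s ≠ 0) : Continuous fun p : ℝ × ℝ => gaussForm g p.1 p.2 :=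
  continuous_of_continuousAt_diag hper hL hinj (gaussForm_periodic hper)
    (fun _ _ => continuousAt_gaussForm (hg.of_le (by norm_num)))
    (fun s => continuousAt_gaussForm_diag hg (hreg s))

lemma continuous_gaussPrimitive {g : ℝ → E3} {L : ℝ} (hg : ContDiff ℝ 2 g) (hL : 0 < L)
    (hper : Function.Periodic g L) (hinj : Set.InjOn g (Set.Ico 0 L))
    (hreg : ∀ s, deriv g s ≠ 0) (h0 : ∀ s, g s ≠ 0) :
    Continuous fun p : ℝ × ℝ => gaussPrimitive g p.1 p.2 :=
  continuous_of_continuousAt_diag hper hL hinj (gaussPrimitive_periodic hper)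
    (fun s t hst => (differentiableAt_gaussPrimitive hg (h0 s) (h0 t) hst).continuousAt)
    (fun s => continuousAt_gaussPrimitive_diag (hg.of_le (by norm_num)) (hreg s) (h0 s))

/-- The integral over the torus of a divergence `∂_s (-2 F(t, s)) - ∂_t (2 F(s, t))` vanishes,
if `F` is continuous and is differentiable off the diagonal. -/
lemma integral_divergence_eq_zero {H F F' : ℝ → ℝ → ℝ} {L : ℝ} (hL : 0 < L)
    (hH : Continuous fun p : ℝ × ℝ => H p.1 p.2) (hF : Continuous fun p : ℝ × ℝ => F p.1 p.2)
    (hHper : ∀ s, Function.Periodic (H s) L) (hFper : ∀ s, Function.Periodic (F s) L)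
    (hFper' : ∀ s t, F (s + L) t = F s t)
    (hd₁ : ∀ s τ, 0 < τ → τ < L → DifferentiableAt ℝ (fun p : ℝ × ℝ => F p.1 p.2) (s, s + τ))
    (hd₂ : ∀ s τ, 0 < τ → τ < L → DifferentiableAt ℝ (fun p : ℝ × ℝ => F p.1 p.2) (s + τ, s))
    (hF'₁ : ∀ s τ, 0 < τ → τ < L → HasDerivAt (F s) (F' s (s + τ)) (s + τ))
    (hF'₂ : ∀ s τ, 0 < τ → τ < L → HasDerivAt (F (s + τ)) (F' (s + τ) s) s)
    (hHF : ∀ s τ, 0 < τ → τ < L → H s (s + τ) = -2 * (F' s (s + τ) + F' (s + τ) s)) :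
    ∫ s in (0:ℝ)..L, ∫ t in (0:ℝ)..L, H s t = 0 := by
  have hshift (s : ℝ) : ∫ t in (0:ℝ)..L, H s t = ∫ τ in (0:ℝ)..L, H s (s + τ) := by
    rw [intervalIntegral.integral_comp_add_left (H s), add_zero,
      (hHper s).intervalIntegral_add_eq s 0, zero_add]
  simp only [hshift]
  set G : ℝ × ℝ → ℝ := fun p => F p.1 p.2 with hG
  have hpartial {s t d : ℝ} (hdiff : DifferentiableAt ℝ G (s, t)) (hd : HasDerivAt (F s) d t) :
      fderiv ℝ G (s, t) (0, 1) = d := by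
    have h := hdiff.hasFDerivAt.comp_hasDerivAt t
      ((hasDerivAt_const t s).prodMk (hasDerivAt_id t))
    exact h.unique hd
  let m₁ : ℝ × ℝ →L[ℝ] ℝ × ℝ :=
    (ContinuousLinearMap.fst ℝ ℝ ℝ).prod
      (ContinuousLinearMap.fst ℝ ℝ ℝ + ContinuousLinearMap.snd ℝ ℝ ℝ)
  let m₂ : ℝ × ℝ →L[ℝ] ℝ × ℝ :=
    (ContinuousLinearMap.fst ℝ ℝ ℝ + ContinuousLinearMap.snd ℝ ℝ ℝ).prod
      (ContinuousLinearMap.fst ℝ ℝ ℝ)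
  have hm₁ (p : ℝ × ℝ) : m₁ p = (p.1, p.1 + p.2) := rfl
  have hm₂ (p : ℝ × ℝ) : m₂ p = (p.1 + p.2, p.1) := rfl
  let D₁ : ℝ × ℝ → ℝ × ℝ →L[ℝ] ℝ := fun p => (fderiv ℝ G (m₁ p)).comp m₁
  let D₂ : ℝ × ℝ → ℝ × ℝ →L[ℝ] ℝ := fun p => (fderiv ℝ G (m₂ p)).comp m₂
  let u' : ℝ × ℝ → ℝ × ℝ →L[ℝ] ℝ := fun p => (-2 : ℝ) • D₂ p
  let v₀ : ℝ × ℝ → ℝ × ℝ →L[ℝ] ℝ := fun p => (-2 : ℝ) • (D₁ p - D₂ p)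
  let v' : ℝ × ℝ → ℝ × ℝ →L[ℝ] ℝ := fun p =>
    v₀ p + (H p.1 (p.1 + p.2) - u' p (1, 0) - v₀ p (0, 1)) • ContinuousLinearMap.snd ℝ ℝ ℝ
  have hsum (p : ℝ × ℝ) : u' p (1, 0) + v' p (0, 1) = H p.1 (p.1 + p.2) := by
    change u' p (1, 0) + (v₀ p (0, 1) + (H p.1 (p.1 + p.2) - u' p (1, 0) - v₀ p (0, 1)) * 1) = _
    ring
  have hD₁ (p : ℝ × ℝ) (h0 : 0 < p.2) (h1 : p.2 < L) :
      HasFDerivAt (fun p : ℝ × ℝ => F p.1 (p.1 + p.2)) (D₁ p) p :=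
    HasFDerivAt.comp (g := G) (f := m₁) p (hd₁ p.1 p.2 h0 h1).hasFDerivAt m₁.hasFDerivAt
  have hD₂ (p : ℝ × ℝ) (h0 : 0 < p.2) (h1 : p.2 < L) :
      HasFDerivAt (fun p : ℝ × ℝ => F (p.1 + p.2) p.1) (D₂ p) p :=
    HasFDerivAt.comp (g := G) (f := m₂) p (hd₂ p.1 p.2 h0 h1).hasFDerivAt m₂.hasFDerivAt
  have hv' (p : ℝ × ℝ) (h0 : 0 < p.2) (h1 : p.2 < L) : v' p = v₀ p := by
    have hz : H p.1 (p.1 + p.2) - u' p (1, 0) - v₀ p (0, 1) = 0 := by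
      have e₁ : D₁ p (0, 1) = F' p.1 (p.1 + p.2) := by
        rw [← hpartial (hd₁ p.1 p.2 h0 h1) (hF'₁ p.1 p.2 h0 h1)]
        simp [D₁, hm₁]
      have e₂ : D₂ p (1, 0) - D₂ p (0, 1) = F' (p.1 + p.2) p.1 := by
        rw [← hpartial (hd₂ p.1 p.2 h0 h1) (hF'₂ p.1 p.2 h0 h1), ← map_sub]
        simp [D₂, hm₂]
      rw [hHF p.1 p.2 h0 h1, ← e₁, ← e₂]
      change _ - (-2) * D₂ p (1, 0) - (-2) * (D₁ p (0, 1) - D₂ p (0, 1)) = 0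
      ring
    simp only [v', hz, zero_smul, add_zero]
  have hcont₁ : Continuous fun p : ℝ × ℝ => F p.1 (p.1 + p.2) := hF.comp m₁.continuous
  have hcont₂ : Continuous fun p : ℝ × ℝ => F (p.1 + p.2) p.1 := hF.comp m₂.continuous
  have hcontH : Continuous fun p : ℝ × ℝ => H p.1 (p.1 + p.2) := hH.comp m₁.continuous
  have key := MeasureTheory.integral2_divergence_prod_of_hasFDerivAt_off_countable
    (fun p : ℝ × ℝ => -2 * F (p.1 + p.2) p.1)
    (fun p : ℝ × ℝ => -2 * (F p.1 (p.1 + p.2) - F (p.1 + p.2) p.1)) u' v' 0 0 L L ∅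
    Set.countable_empty (continuous_const.mul hcont₂).continuousOn
    (continuous_const.mul (hcont₁.sub hcont₂)).continuousOn
    (fun p hp => ?_) (fun p hp => ?_) ?_
  · simp only [hsum] at key
    rw [key]
    have h₁ (x : ℝ) : F x (x + L) = F x x := hFper x x
    have h₂ (y : ℝ) : F (L + y) L = F y 0 := by
      rw [add_comm, hFper', ← hFper y 0, zero_add]
    simp [h₁, h₂, hFper']
  · rw [min_eq_left hL.le, max_eq_right hL.le] at hp
    exact (hD₂ p hp.1.2.1 hp.1.2.2).const_mul (-2)
  · rw [min_eq_left hL.le, max_eq_right hL.le] at hp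
    rw [hv' p hp.1.2.1 hp.1.2.2]
    exact ((hD₁ p hp.1.2.1 hp.1.2.2).sub (hD₂ p hp.1.2.1 hp.1.2.2)).const_mul (-2)
  · simp only [hsum]
    exact hcontH.continuousOn.integrableOn_compact (isCompact_uIcc.prod isCompact_uIcc)

open EuclideanGeometry in
lemma writhe_inversion_zero {g : ℝ → E3} {L r : ℝ} (hg : ContDiff ℝ 2 g) (hL : 0 < L)
    (hper : Function.Periodic g L) (hinj : Set.InjOn g (Set.Ico 0 L))
    (hreg : ∀ s, deriv g s ≠ 0) (h0 : ∀ s, g s ≠ 0) (hr : r ≠ 0) :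
    writhe (fun s => inversion 0 r (g s)) L = -writhe g L := by
  have hd : Differentiable ℝ g := hg.differentiable (by norm_num)
  have hcg := continuous_gaussForm hg hL hper hinj hreg
  have hci := continuous_gaussForm (g := fun s => inversion 0 r (g s)) (L := L)
    (contDiff_const.inversion contDiff_const hg h0) hL
    (fun s => by simp only [hper s])
    ((inversion_injective 0 hr).comp_injOn hinj)
    (fun s => deriv_inversion_comp_ne_zero hr (hd s) (h0 s) (hreg s))
  have hne {s τ : ℝ} (h₀ : 0 < τ) (h₁ : τ < L) := hper.apply_ne_apply_add hL hinj (s := s) h₀ h₁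
  have key := integral_divergence_eq_zero hL (hcg.add hci)
    (continuous_gaussPrimitive hg hL hper hinj hreg h0)
    (H := fun s t => gaussForm g s t + gaussForm (fun s => inversion 0 r (g s)) s t)
    (F' := fun s t => gaussPrimitiveDeriv (g s) (g t) (deriv g s) (deriv g t))
    (fun s => (gaussForm_periodic hper s).add
      (gaussForm_periodic (fun s => by simp only [hper s]) s))
    (gaussPrimitive_periodic hper) (gaussPrimitive_periodic_left hper)
    (fun s τ h₀ h₁ => differentiableAt_gaussPrimitive hg (h0 _) (h0 _) (hne h₀ h₁))
    (fun s τ h₀ h₁ => differentiableAt_gaussPrimitive hg (h0 _) (h0 _) (hne h₀ h₁).symm)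
    (fun s τ h₀ h₁ => hasDerivAt_gaussPrimitive (hd _) (h0 _) (h0 _) (hne h₀ h₁))
    (fun s τ h₀ h₁ => hasDerivAt_gaussPrimitive (hd _) (h0 _) (h0 _) (hne h₀ h₁).symm)
    (fun s τ h₀ h₁ => gaussForm_inversion hr (hd _) (hd _) (h0 _) (h0 _) (hne h₀ h₁))
  have hint {q : ℝ → E3} (hq : Continuous fun p : ℝ × ℝ => gaussForm q p.1 p.2) (s : ℝ) :
      IntervalIntegrable (gaussForm q s) MeasureTheory.volume 0 L :=
    (hq.comp (Continuous.prodMk_right s)).intervalIntegrable _ _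
  have hint' {q : ℝ → E3} (hq : Continuous fun p : ℝ × ℝ => gaussForm q p.1 p.2) :
      IntervalIntegrable (fun s => ∫ t in (0:ℝ)..L, gaussForm q s t) MeasureTheory.volume 0 L :=
    (intervalIntegral.continuous_parametric_intervalIntegral_of_continuous' hq _ _
      ).intervalIntegrable _ _
  simp only [intervalIntegral.integral_add (hint hcg _) (hint hci _)] at key
  rw [intervalIntegral.integral_add (hint' hcg) (hint' hci)] at key
  have hw (q : ℝ → E3) : writhe q L =
      (1 / (4 * π)) * ∫ s in (0:ℝ)..L, ∫ t in (0:ℝ)..L, gaussForm q s t := rfl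
  rw [hw, hw]
  linear_combination (1 / (4 * π)) * key

lemma writhe_add_const (g : ℝ → E3) (L : ℝ) (c : E3) :
    writhe (fun s => c + g s) L = writhe g L := by
  simp [writhe, deriv_const_add]

/-- Banchoff–White. The writhe of a knot changes sign under an
inversion in a sphere: if `f` is a smooth arc-length parametrized knot of period `L`
and `I = inv3 P r` is the inversion in the sphere of center `P ∉ K` and radius `r`,
then `Wr(I ∘ f) = −Wr(f)`. -/
theorem writhe_inversion
    (f : ℝ → E3) (L : ℝ) (hL : 0 < L)
    (hf : ContDiff ℝ (⊤ : ℕ∞) f) (hper : Function.Periodic f L)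
    (harc : ∀ s, ‖deriv f s‖ = 1) (hinj : Set.InjOn f (Set.Ico 0 L))
    (P : E3) (hP : P ∉ f '' Set.Icc 0 L) (r : ℝ) (hr : 0 < r) :
    writhe (fun s => inv3 P r (f s)) L = - writhe f L := by
  have hP' (s : ℝ) : f s - P ≠ 0 := fun h => hP <| by
    rw [← sub_eq_zero.1 h]
    obtain ⟨t, ht, hst⟩ := hper.exists_mem_Ico₀ hL s
    exact ⟨t, Set.Ico_subset_Icc_self ht, hst.symm⟩
  have h := writhe_inversion_zero (g := fun s => f s - P) (r := r)
    (((contDiff_infty.1 hf 2)).sub contDiff_const) hL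
    (fun s => by simp only [hper s]) (fun s hs t ht hst => hinj hs ht (sub_left_injective hst))
    (fun s h => by
      rw [deriv_sub_const] at h
      simpa [h] using harc s) hP' hr.ne'
  rw [← writhe_add_const _ L P, ← writhe_add_const (fun s => f s - P) L P] at h
  simpa only [add_sub_cancel, EuclideanGeometry.inversion, inv3, dist_zero_right, vsub_eq_sub,
    vadd_eq_add, sub_zero, add_zero, div_pow] using h
end
end

section
/- Let f : ℝ → ℝ³ be a C^∞ embedding of period L parametrized by arc length with nowhere vanishing curvature κ(s) = |f''(s)| > 0, let P ∉ f([0,L]), r > 0, and set f̃ = I_{P,r}∘f. If f̃ also has nowhere vanishing curvature, then the total torsions satisfy Tω(f̃) ≡ −Tω(f) (mod ℤ), i.e. Tω(f̃) + Tω(f) ∈ ℤ. -/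
noncomputable section
open Real

theorem dot3_self_eq_norm_sq (u : E3) : dot3 u u = ‖u‖ ^ 2 := by
  simp [EuclideanSpace.norm_sq_eq, Fin.sum_univ_three, dot3, ← pow_two]

theorem cross3_apply_zero (u v : E3) : cross3 u v 0 = u 1 * v 2 - u 2 * v 1 := rfl
theorem cross3_apply_one (u v : E3) : cross3 u v 1 = u 2 * v 0 - u 0 * v 2 := rfl
theorem cross3_apply_two (u v : E3) : cross3 u v 2 = u 0 * v 1 - u 1 * v 0 := rfl

theorem E3.ext {u v : E3} (h0 : u 0 = v 0) (h1 : u 1 = v 1) (h2 : u 2 = v 2) : u = v := by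
  ext i
  fin_cases i <;> assumption

theorem E3.lagrange (u v : E3) :
    dot3 (cross3 u v) (cross3 u v) = dot3 u u * dot3 v v - dot3 u v ^ 2 := by
  simp only [dot3, cross3_apply_zero, cross3_apply_one, cross3_apply_two]
  ring

/-- `T`, `A` and `T × A` span `E3` when `T × A ≠ 0`. -/
theorem E3.exists_coords {T A : E3} (h : dot3 (cross3 T A) (cross3 T A) ≠ 0) (v : E3) :
    ∃ a b c : ℝ, v = a • T + b • A + c • cross3 T A := by
  refine ⟨det3 v A (cross3 T A) / dot3 (cross3 T A) (cross3 T A),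
    det3 T v (cross3 T A) / dot3 (cross3 T A) (cross3 T A),
    det3 T A v / dot3 (cross3 T A) (cross3 T A), ?_⟩
  apply E3.ext <;>
  · simp only [PiLp.add_apply, PiLp.smul_apply, smul_eq_mul]
    field_simp
    simp only [det3, dot3, cross3_apply_zero, cross3_apply_one, cross3_apply_two]
    ring

section Frame

variable {T A : E3} {k : ℝ} (hTT : dot3 T T = 1) (hTA : dot3 T A = 0) (hAA : dot3 A A = k)
include hTT hTA hAA

theorem dot3_frame (a b c a' b' c' : ℝ) :
    dot3 (a • T + b • A + c • cross3 T A) (a' • T + b' • A + c' • cross3 T A) =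
      a * a' + k * (b * b' + c * c') := by
  have hC : dot3 (cross3 T A) (cross3 T A) = k := by
    rw [E3.lagrange, hTT, hTA, hAA]; ring
  simp only [dot3, PiLp.add_apply, PiLp.smul_apply, smul_eq_mul, cross3_apply_zero,
    cross3_apply_one, cross3_apply_two] at *
  linear_combination a * a' * hTT + (a * b' + b * a') * hTA + b * b' * hAA + c * c' * hC

theorem det3_frame (a b c a' b' c' a'' b'' c'' : ℝ) :
    det3 (a • T + b • A + c • cross3 T A) (a' • T + b' • A + c' • cross3 T A)
      (a'' • T + b'' • A + c'' • cross3 T A) =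
      k * (a * (b' * c'' - c' * b'') - b * (a' * c'' - c' * a'') + c * (a' * b'' - b' * a'')) := by
  have hC : dot3 (cross3 T A) (cross3 T A) = k := by
    rw [E3.lagrange, hTT, hTA, hAA]; ring
  rw [← hC]
  simp only [det3, dot3, PiLp.add_apply, PiLp.smul_apply, smul_eq_mul, cross3_apply_zero,
    cross3_apply_one, cross3_apply_two]
  ring

end Frame

/-- Pointwise identity between the torsions of a curve and of its image under an inversion.
Here `x`, `T`, `A`, `J` are the position and the first three derivatives of an arc-length
parametrized curve, and `h` is the conformal factor of the inversion. -/
theorem torsion_inversion_identity {x T A J : E3} {c ρ h h₁ h₂ h₃ : ℝ}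
    (hTT : dot3 T T = 1) (hTA : dot3 T A = 0) (hTJ : dot3 T J = -dot3 A A)
    (hA : 0 < dot3 A A) (hρ : dot3 x x = ρ) (hρ0 : ρ ≠ 0) (hc : c ≠ 0)
    (hh : h = c / ρ) (hh₁ : h₁ = -(2 * c * dot3 x T) / ρ ^ 2)
    (hh₂ : h₂ = -(2 * c * (1 + dot3 x A)) / ρ ^ 2 + 8 * c * dot3 x T ^ 2 / ρ ^ 3)
    (hh₃ : h₃ = -(2 * c * dot3 x J) / ρ ^ 2 + 24 * c * dot3 x T * (1 + dot3 x A) / ρ ^ 3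
      - 48 * c * dot3 x T ^ 3 / ρ ^ 4)
    {u v u' v' : ℝ} (hu : u = ρ * dot3 A A + 2 * dot3 x A) (hv : v = 2 * det3 x T A)
    (hu' : u' = 2 * dot3 x T * dot3 A A + 2 * ρ * dot3 A J + 2 * dot3 x J)
    (hv' : v' = 2 * det3 x T J)
    {g₁ g₂ g₃ : E3} (hg₁ : g₁ = h₁ • x + h • T) (hg₂ : g₂ = h₂ • x + (2 * h₁) • T + h • A)
    (hg₃ : g₃ = h₃ • x + (3 * h₂) • T + (3 * h₁) • A + h • J) (hreg : cross3 g₁ g₂ ≠ 0) :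
    u ^ 2 + v ^ 2 ≠ 0 ∧
    det3 g₁ g₂ g₃ / ‖cross3 g₁ g₂‖ ^ 2 * h + det3 T A J / dot3 A A
      = -((u * v' - v * u') / (u ^ 2 + v ^ 2)) ∧ dot3 g₁ g₁ = h ^ 2 := by
  have hreg' : ‖cross3 g₁ g₂‖ ^ 2 ≠ 0 := by simpa using hreg
  rw [← dot3_self_eq_norm_sq, E3.lagrange] at hreg' ⊢
  obtain ⟨k, hk⟩ : ∃ k, dot3 A A = k := ⟨_, rfl⟩
  rw [hk] at hTJ hA hu hu' ⊢
  have hC : dot3 (cross3 T A) (cross3 T A) ≠ 0 := by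
    rw [E3.lagrange, hTT, hTA, hk]; simpa using hA.ne'
  have dot := dot3_frame hTT hTA hk
  have det := det3_frame hTT hTA hk
  obtain ⟨p, q, w, hx⟩ := E3.exists_coords hC x
  obtain ⟨l, m, n, hJ⟩ := E3.exists_coords hC J
  have eT : T = (1 : ℝ) • T + (0 : ℝ) • A + (0 : ℝ) • cross3 T A := by simp
  have eA : A = (0 : ℝ) • T + (1 : ℝ) • A + (0 : ℝ) • cross3 T A := by simp
  have hl : l = -k := by
    rw [← hTJ, hJ]
    have := dot 1 0 0 l m n
    rw [← eT] at this
    rw [this]; ring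
  have xT : dot3 x T = p := by
    have := dot p q w 1 0 0
    rw [← eT, ← hx] at this
    rw [this]; ring
  have xA : dot3 x A = k * q := by
    have := dot p q w 0 1 0
    rw [← eA, ← hx] at this
    rw [this]; ring
  have xJ : dot3 x J = p * l + k * (q * m + w * n) := by
    rw [hx, hJ, dot]
  have AJ : dot3 A J = k * m := by
    have := dot 0 1 0 l m n
    rw [← eA, ← hJ] at this
    rw [this]; ring
  have xTA : det3 x T A = k * w := by
    have := det p q w 1 0 0 0 1 0
    rw [← eA, ← eT, ← hx] at this
    rw [this]; ring
  have xTJ : det3 x T J = k * (w * m - q * n) := by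
    have := det p q w 1 0 0 l m n
    rw [← eT, ← hx, ← hJ] at this
    rw [this]; ring
  have TAJ : det3 T A J = k * n := by
    have := det 1 0 0 0 1 0 l m n
    rw [← eA, ← eT, ← hJ] at this
    rw [this]; ring
  have xx : ρ = p * p + k * (q * q + w * w) := by
    rw [← hρ, hx, dot]
  have e₁ : g₁ = (h₁ * p + h) • T + (h₁ * q) • A + (h₁ * w) • cross3 T A := by
    rw [hg₁, hx]; module
  have e₂ : g₂ = (h₂ * p + 2 * h₁) • T + (h₂ * q + h) • A + (h₂ * w) • cross3 T A := by
    rw [hg₂, hx]; module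
  have e₃ : g₃ = (h₃ * p + 3 * h₂ + h * l) • T + (h₃ * q + 3 * h₁ + h * m) • A +
      (h₃ * w + h * n) • cross3 T A := by
    rw [hg₃, hx, hJ]; module
  rw [xT, xA] at hh₂ hh₃
  rw [xT] at hh₁ hu'
  rw [xA] at hu
  rw [xJ] at hh₃ hu'
  subst hl
  have hk0 : k ≠ 0 := hA.ne'
  have hcross : k * ρ ^ 2 * (dot3 g₁ g₁ * dot3 g₂ g₂ - dot3 g₁ g₂ ^ 2) =
      h ^ 4 * (u ^ 2 + v ^ 2) := by
    rw [e₁, e₂, dot, dot, dot, hh₂, hh₁, hh, hu, hv, xTA]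
    field_simp
    rw [xx]
    ring
  have hdet : k * ρ ^ 2 * det3 g₁ g₂ g₃ =
      -h ^ 3 * (n * (u ^ 2 + v ^ 2) + (u * v' - v * u')) := by
    rw [e₁, e₂, e₃, det, hh₃, hh₂, hh₁, hh, hu, hv, hu', hv', xTA, xTJ, AJ]
    field_simp
    rw [xx]
    ring
  have hspeed : dot3 g₁ g₁ = h ^ 2 := by
    rw [e₁, dot, hh₁, hh]
    field_simp
    rw [xx]
    ring
  have hS : u ^ 2 + v ^ 2 ≠ 0 := fun h0 => by
    rw [h0, mul_zero] at hcross
    exact mul_ne_zero (mul_ne_zero hk0 (pow_ne_zero 2 hρ0)) hreg' hcross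
  have hh0 : h ≠ 0 := by rw [hh]; exact div_ne_zero hc hρ0
  refine ⟨hS, ?_, hspeed⟩
  generalize dot3 g₁ g₁ * dot3 g₂ g₂ - dot3 g₁ g₂ ^ 2 = X at *
  generalize det3 g₁ g₂ g₃ = D at *
  have hX : X = h ^ 4 * (u ^ 2 + v ^ 2) / (k * ρ ^ 2) := by
    field_simp
    linarith
  have hD : D = -h ^ 3 * (n * (u ^ 2 + v ^ 2) + (u * v' - v * u')) / (k * ρ ^ 2) := by
    field_simp
    linarith
  rw [TAJ, hX, hD]
  generalize u ^ 2 + v ^ 2 = S at *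
  field_simp
  ring

/-- A closed curve in the punctured plane has an integral winding number. -/
theorem exists_int_integral_arg_eq {u v u' v' : ℝ → ℝ} {L : ℝ}
    (hu : ∀ s, HasDerivAt u (u' s) s) (hv : ∀ s, HasDerivAt v (v' s) s)
    (hu' : Continuous u') (hv' : Continuous v') (h0 : ∀ s, u s ^ 2 + v s ^ 2 ≠ 0)
    (huL : u L = u 0) (hvL : v L = v 0) :
    ∃ k : ℤ, ∫ s in (0:ℝ)..L, (u s * v' s - v s * u' s) / (u s ^ 2 + v s ^ 2) = 2 * π * k := by
  set z : ℝ → ℂ := fun s => u s + v s * Complex.I with hz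
  set w : ℝ → ℂ := fun s => u' s + v' s * Complex.I with hw
  have hzw : ∀ s, HasDerivAt z (w s) s := fun s =>
    (hu s).ofReal_comp.add ((hv s).ofReal_comp.mul_const Complex.I)
  have hz0 : ∀ s, z s ≠ 0 := fun s hs => h0 s <| by
    have h1 : u s = 0 := by simpa [hz] using congrArg Complex.re hs
    have h2 : v s = 0 := by simpa [hz] using congrArg Complex.im hs
    simp [h1, h2]
  have hzc : Continuous z := continuous_iff_continuousAt.2 fun s => (hzw s).continuousAt
  have hwc : Continuous w := by
    fun_prop
  have hq : Continuous fun s => w s / z s := hwc.div hzc hz0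
  have hF : ∀ s, HasDerivAt (fun t => ∫ x in (0:ℝ)..t, w x / z x) (w s / z s) s := fun s =>
    intervalIntegral.integral_hasDerivAt_right (hq.intervalIntegrable _ _)
      (hq.stronglyMeasurableAtFilter _ _) hq.continuousAt
  have hconst : ∀ s, HasDerivAt (fun t => z t * Complex.exp (-∫ x in (0:ℝ)..t, w x / z x)) 0 s := by
    intro s
    refine ((hzw s).mul (hF s).neg.cexp).congr_deriv ?_
    have := hz0 s
    field_simp
    ring
  have hexp : Complex.exp (-∫ x in (0:ℝ)..L, w x / z x) = 1 := by
    have := is_const_of_deriv_eq_zero (fun s => (hconst s).differentiableAt)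
      (fun s => (hconst s).deriv) L 0
    have hzL : z L = z 0 := by simp only [hz, huL, hvL]
    simp only [intervalIntegral.integral_same, neg_zero, Complex.exp_zero, hzL] at this
    exact mul_left_cancel₀ (hz0 0) this
  obtain ⟨n, hn⟩ := Complex.exp_eq_one_iff.1 hexp
  refine ⟨-n, ?_⟩
  have him : ∫ s in (0:ℝ)..L, (u s * v' s - v s * u' s) / (u s ^ 2 + v s ^ 2) =
      (∫ x in (0:ℝ)..L, w x / z x).im := by
    have := Complex.imCLM.intervalIntegral_comp_comm
      (hq.intervalIntegrable (μ := MeasureTheory.volume) 0 L)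
    simp only [Complex.imCLM_apply] at this
    rw [← this]
    refine intervalIntegral.integral_congr fun s _ => ?_
    simp only [hz, hw, Complex.div_im, Complex.normSq_apply]
    simp
    ring
  rw [him, ← neg_neg (∫ x in (0:ℝ)..L, w x / z x), hn]
  simp
  ring

theorem HasDerivAt.apply_E3 {u : ℝ → E3} {u' : E3} {s : ℝ} (hu : HasDerivAt u u' s) (i : Fin 3) :
    HasDerivAt (fun t => u t i) (u' i) s :=
  (EuclideanSpace.proj i : E3 →L[ℝ] ℝ).hasFDerivAt.comp_hasDerivAt s hu

theorem HasDerivAt.dot3 {u v : ℝ → E3} {u' v' : E3} {s : ℝ} (hu : HasDerivAt u u' s)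
    (hv : HasDerivAt v v' s) :
    HasDerivAt (fun t => dot3 (u t) (v t)) (dot3 u' (v s) + dot3 (u s) v') s := by
  refine ((((hu.apply_E3 0).mul (hv.apply_E3 0)).add ((hu.apply_E3 1).mul (hv.apply_E3 1))).add
    ((hu.apply_E3 2).mul (hv.apply_E3 2))).congr_deriv ?_
  simp only [_root_.dot3]
  ring

theorem HasDerivAt.det3 {u v w : ℝ → E3} {u' v' w' : E3} {s : ℝ} (hu : HasDerivAt u u' s)
    (hv : HasDerivAt v v' s) (hw : HasDerivAt w w' s) :
    HasDerivAt (fun t => det3 (u t) (v t) (w t))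
      (det3 u' (v s) (w s) + det3 (u s) v' (w s) + det3 (u s) (v s) w') s := by
  have minor (i j : Fin 3) := ((hv.apply_E3 i).mul (hw.apply_E3 j)).sub
    ((hv.apply_E3 j).mul (hw.apply_E3 i))
  refine ((((hu.apply_E3 0).mul (minor 1 2)).add ((hu.apply_E3 1).mul (minor 2 0))).add
    ((hu.apply_E3 2).mul (minor 0 1))).congr_deriv ?_
  simp only [_root_.det3, _root_.dot3, cross3_apply_zero, cross3_apply_one, cross3_apply_two,
    Pi.sub_apply, Pi.mul_apply]
  ring

theorem Continuous.dot3 {u v : ℝ → E3} (hu : Continuous u) (hv : Continuous v) :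
    Continuous fun t => dot3 (u t) (v t) := by
  unfold _root_.dot3
  fun_prop

theorem Continuous.det3 {u v w : ℝ → E3} (hu : Continuous u) (hv : Continuous v)
    (hw : Continuous w) : Continuous fun t => det3 (u t) (v t) (w t) := by
  simp only [_root_.det3, _root_.dot3, cross3_apply_zero, cross3_apply_one, cross3_apply_two]
  fun_prop

theorem Function.Periodic.deriv {E : Type*} [NormedAddCommGroup E] [NormedSpace ℝ E]
    {f : ℝ → E} {L : ℝ} (h : Function.Periodic f L) :
    Function.Periodic (_root_.deriv f) L := fun s => by
  rw [← deriv_comp_add_const, h.funext]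

theorem dot3_comm (u v : E3) : dot3 u v = dot3 v u := by
  simp only [dot3]
  ring

theorem torsionArc_eq {f : ℝ → E3} {s : ℝ}
    (hd : DifferentiableAt ℝ (deriv (deriv f)) s) (hκ : 0 < ‖deriv (deriv f) s‖) :
    torsionArc f s = det3 (deriv f s) (deriv (deriv f) s) (deriv (deriv (deriv f)) s) /
      dot3 (deriv (deriv f) s) (deriv (deriv f) s) := by
  have hκ' : DifferentiableAt ℝ (fun t => ‖deriv (deriv f) t‖⁻¹) s :=
    (hd.norm ℝ (norm_pos_iff.1 hκ)).inv hκ.ne'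
  have hderiv : deriv (e2 f) s = ‖deriv (deriv f) s‖⁻¹ • deriv (deriv (deriv f)) s +
      deriv (fun t => ‖deriv (deriv f) t‖⁻¹) s • deriv (deriv f) s :=
    (hκ'.hasDerivAt.smul hd.hasDerivAt).deriv
  rw [torsionArc, hderiv, dot3_self_eq_norm_sq, e3, e2]
  field_simp
  simp only [dot3, det3, PiLp.add_apply, PiLp.smul_apply, smul_eq_mul, cross3_apply_zero,
    cross3_apply_one, cross3_apply_two]
  field_simp
  ring

section Inversion

variable {X T A J : ℝ → E3} (hX : ∀ s, HasDerivAt X (T s) s)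
  (hT : ∀ s, HasDerivAt T (A s) s) (hA : ∀ s, HasDerivAt A (J s) s)
  (hX0 : ∀ s, dot3 (X s) (X s) ≠ 0) (hTT : ∀ s, dot3 (T s) (T s) = 1)

include hX hX0 in
theorem hasDerivAt_div_dot3_self (c s : ℝ) :
    HasDerivAt (fun t => c / dot3 (X t) (X t))
      (-(2 * c * dot3 (X s) (T s)) / dot3 (X s) (X s) ^ 2) s := by
  refine ((hasDerivAt_const s c).fun_div ((hX s).dot3 (hX s)) (hX0 s)).congr_deriv ?_
  rw [dot3_comm (T s)]
  ring

include hX hT hX0 hTT in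
theorem hasDerivAt_deriv_div_dot3_self (c s : ℝ) :
    HasDerivAt (fun t => -(2 * c * dot3 (X t) (T t)) / dot3 (X t) (X t) ^ 2)
      (-(2 * c * (1 + dot3 (X s) (A s))) / dot3 (X s) (X s) ^ 2 +
        8 * c * dot3 (X s) (T s) ^ 2 / dot3 (X s) (X s) ^ 3) s := by
  refine ((((hX s).dot3 (hT s)).const_mul (2 * c)).fun_neg.fun_div
    (((hX s).dot3 (hX s)).fun_pow 2) (pow_ne_zero 2 (hX0 s))).congr_deriv ?_
  have := hX0 s
  rw [dot3_comm (T s) (X s), hTT]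
  field_simp
  ring

include hX hT hA hX0 hTT in
theorem hasDerivAt_deriv_deriv_div_dot3_self (hTA : ∀ s, dot3 (T s) (A s) = 0) (c s : ℝ) :
    HasDerivAt (fun t => -(2 * c * (1 + dot3 (X t) (A t))) / dot3 (X t) (X t) ^ 2 +
        8 * c * dot3 (X t) (T t) ^ 2 / dot3 (X t) (X t) ^ 3)
      (-(2 * c * dot3 (X s) (J s)) / dot3 (X s) (X s) ^ 2 +
        24 * c * dot3 (X s) (T s) * (1 + dot3 (X s) (A s)) / dot3 (X s) (X s) ^ 3 -
        48 * c * dot3 (X s) (T s) ^ 3 / dot3 (X s) (X s) ^ 4) s := by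
  have hXX := (hX s).dot3 (hX s)
  refine (((((hX s).dot3 (hA s)).const_add 1).const_mul (2 * c)).fun_neg.fun_div
    (hXX.fun_pow 2) (pow_ne_zero 2 (hX0 s))).fun_add
    (((((hX s).dot3 (hT s)).fun_pow 2).const_mul (8 * c)).fun_div
    (hXX.fun_pow 3) (pow_ne_zero 3 (hX0 s))) |>.congr_deriv ?_
  have := hX0 s
  rw [dot3_comm (T s) (X s), hTT, hTA]
  field_simp
  ring

end Inversion

/-- If `f` has nowhere vanishing curvature and the inverted knot
`f̃ = I_{P,r} ∘ f` also has nowhere vanishing curvature, then the total torsions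
satisfy `Tω(f̃) + Tω(f) ∈ ℤ`. -/
theorem totalTorsion_inversion
    (f : ℝ → E3) (L : ℝ) (hL : 0 < L)
    (hf : ContDiff ℝ (⊤ : ℕ∞) f) (hper : Function.Periodic f L)
    (harc : ∀ s, ‖deriv f s‖ = 1) (hinj : Set.InjOn f (Set.Ico 0 L))
    (hκ : ∀ s, ‖deriv (deriv f) s‖ > 0)
    (P : E3) (hP : P ∉ f '' Set.Icc 0 L) (r : ℝ) (hr : 0 < r)
    (hreg : ∀ s, cross3 (deriv (fun t => inv3 P r (f t)) s)
        (deriv (deriv (fun t => inv3 P r (f t))) s) ≠ 0) :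
    ∃ k : ℤ,
      totalTorsionGen (fun t => inv3 P r (f t)) L + totalTorsionArc f L = (k : ℝ) := by
  obtain ⟨X, hXdef⟩ : ∃ X : ℝ → E3, X = fun t => f t - P := ⟨_, rfl⟩
  obtain ⟨T, hTdef⟩ : ∃ T, T = deriv f := ⟨_, rfl⟩
  obtain ⟨A, hAdef⟩ : ∃ A, A = deriv T := ⟨_, rfl⟩
  obtain ⟨J, hJdef⟩ : ∃ J, J = deriv A := ⟨_, rfl⟩
  have cT : ContDiff ℝ (⊤ : ℕ∞) T := hTdef ▸ (contDiff_infty_iff_deriv.1 hf).2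
  have cA : ContDiff ℝ (⊤ : ℕ∞) A := hAdef ▸ (contDiff_infty_iff_deriv.1 cT).2
  have cJ : Continuous J := hJdef ▸ (contDiff_infty_iff_deriv.1 cA).2.continuous
  have dX : ∀ s, HasDerivAt X (T s) s := fun s => by
    rw [hXdef, hTdef]
    exact ((contDiff_infty_iff_deriv.1 hf).1 s).hasDerivAt.sub_const P
  have dT : ∀ s, HasDerivAt T (A s) s := fun s =>
    hAdef ▸ ((contDiff_infty_iff_deriv.1 cT).1 s).hasDerivAt
  have dA : ∀ s, HasDerivAt A (J s) s := fun s =>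
    hJdef ▸ ((contDiff_infty_iff_deriv.1 cA).1 s).hasDerivAt
  have cX : Continuous X := continuous_iff_continuousAt.2 fun s => (dX s).continuousAt
  have hX0 : ∀ s, dot3 (X s) (X s) ≠ 0 := fun s => by
    rw [dot3_self_eq_norm_sq, hXdef]
    refine pow_ne_zero 2 (norm_ne_zero_iff.2 (sub_ne_zero.2 fun h => hP ?_))
    obtain ⟨t, ht, hst⟩ := hper.exists_mem_Ico₀ hL s
    exact ⟨t, Set.Ico_subset_Icc_self ht, by rw [← hst, h]⟩
  have hTT : ∀ s, dot3 (T s) (T s) = 1 := fun s => by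
    rw [dot3_self_eq_norm_sq, hTdef, harc, one_pow]
  have hTA : ∀ s, dot3 (T s) (A s) = 0 := fun s => by
    have h1 := (dT s).dot3 (dT s)
    simp only [hTT] at h1
    have h2 := h1.unique (hasDerivAt_const s 1)
    rw [dot3_comm (A s)] at h2
    linarith
  have hTJ : ∀ s, dot3 (T s) (J s) = -dot3 (A s) (A s) := fun s => by
    have h1 := (dT s).dot3 (dA s)
    simp only [hTA] at h1
    have h2 := h1.unique (hasDerivAt_const s 0)
    linarith
  have hAA : ∀ s, 0 < dot3 (A s) (A s) := fun s => by
    rw [dot3_self_eq_norm_sq, hAdef, hTdef]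
    exact pow_pos (hκ s) 2
  obtain ⟨h, hh⟩ : ∃ h : ℝ → ℝ, h = fun t => r ^ 2 / dot3 (X t) (X t) := ⟨_, rfl⟩
  obtain ⟨h₁, hh₁⟩ : ∃ h : ℝ → ℝ, h = fun t =>
    -(2 * r ^ 2 * dot3 (X t) (T t)) / dot3 (X t) (X t) ^ 2 := ⟨_, rfl⟩
  obtain ⟨h₂, hh₂⟩ : ∃ h : ℝ → ℝ, h = fun t =>
    -(2 * r ^ 2 * (1 + dot3 (X t) (A t))) / dot3 (X t) (X t) ^ 2 +
        8 * r ^ 2 * dot3 (X t) (T t) ^ 2 / dot3 (X t) (X t) ^ 3 := ⟨_, rfl⟩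
  obtain ⟨h₃, hh₃⟩ : ∃ h : ℝ → ℝ, h = fun t =>
    -(2 * r ^ 2 * dot3 (X t) (J t)) / dot3 (X t) (X t) ^ 2 +
        24 * r ^ 2 * dot3 (X t) (T t) * (1 + dot3 (X t) (A t)) / dot3 (X t) (X t) ^ 3 -
        48 * r ^ 2 * dot3 (X t) (T t) ^ 3 / dot3 (X t) (X t) ^ 4 := ⟨_, rfl⟩
  have dh : ∀ s, HasDerivAt h (h₁ s) s := fun s => by
    rw [hh, hh₁]
    exact hasDerivAt_div_dot3_self dX hX0 _ s
  have dh₁ : ∀ s, HasDerivAt h₁ (h₂ s) s := fun s => by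
    rw [hh₁, hh₂]
    exact hasDerivAt_deriv_div_dot3_self dX dT hX0 hTT _ s
  have dh₂ : ∀ s, HasDerivAt h₂ (h₃ s) s := fun s => by
    rw [hh₂, hh₃]
    exact hasDerivAt_deriv_deriv_div_dot3_self dX dT dA hX0 hTT hTA _ s
  have hg : (fun t => inv3 P r (f t)) = fun t => P + h t • X t := by
    funext t
    rw [inv3, hh, hXdef]
    simp only [dot3_self_eq_norm_sq]
  have hg₁ : deriv (fun t => inv3 P r (f t)) = fun s => h₁ s • X s + h s • T s := by
    funext s
    rw [hg, add_comm]
    exact (((dh s).fun_smul (dX s)).const_add P).deriv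
  have hg₂ : deriv (deriv (fun t => inv3 P r (f t))) =
      fun s => h₂ s • X s + (2 * h₁ s) • T s + h s • A s := by
    funext s
    rw [hg₁, (((dh₁ s).fun_smul (dX s)).fun_add ((dh s).fun_smul (dT s))).deriv]
    module
  have hg₃ : deriv (deriv (deriv (fun t => inv3 P r (f t)))) =
      fun s => h₃ s • X s + (3 * h₂ s) • T s + (3 * h₁ s) • A s + h s • J s := by
    funext s
    rw [hg₂, ((((dh₂ s).fun_smul (dX s)).fun_add (((dh₁ s).const_mul 2).fun_smul (dT s))).fun_add
      ((dh s).fun_smul (dA s))).deriv]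
    module
  set u : ℝ → ℝ := fun s => dot3 (X s) (X s) * dot3 (A s) (A s) + 2 * dot3 (X s) (A s) with hu
  set v : ℝ → ℝ := fun s => 2 * det3 (X s) (T s) (A s) with hv
  set u' : ℝ → ℝ := fun s => 2 * dot3 (X s) (T s) * dot3 (A s) (A s) +
    2 * dot3 (X s) (X s) * dot3 (A s) (J s) + 2 * dot3 (X s) (J s) with hu'
  set v' : ℝ → ℝ := fun s => 2 * det3 (X s) (T s) (J s) with hv'
  have key := fun s => torsion_inversion_identity (hTT s) (hTA s) (hTJ s) (hAA s) rfl (hX0 s)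
    (pow_ne_zero 2 hr.ne') (congrFun hh s) (congrFun hh₁ s) (congrFun hh₂ s) (congrFun hh₃ s)
    (congrFun hu s) (congrFun hv s) (congrFun hu' s) (congrFun hv' s)
    (congrFun hg₁ s) (congrFun hg₂ s) (congrFun hg₃ s) (hreg s)
  have du : ∀ s, HasDerivAt u (u' s) s := fun s => by
    refine ((((dX s).dot3 (dX s)).fun_mul ((dA s).dot3 (dA s))).fun_add
      (((dX s).dot3 (dA s)).const_mul 2)).congr_deriv ?_
    rw [dot3_comm (T s) (X s), hTA, dot3_comm (J s)]
    ring
  have dv : ∀ s, HasDerivAt v (v' s) s := fun s => by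
    refine (((dX s).det3 (dT s) (dA s)).const_mul 2).congr_deriv ?_
    simp only [hv', det3, dot3, cross3_apply_zero, cross3_apply_one, cross3_apply_two]
    ring
  have cu' : Continuous u' := by
    have h1 := cX.dot3 cT.continuous
    have h2 := cA.continuous.dot3 cA.continuous
    have h3 := cX.dot3 cX
    have h4 := cA.continuous.dot3 cJ
    have h5 := cX.dot3 cJ
    fun_prop
  have cv' : Continuous v' := (cX.det3 cT.continuous cJ).const_mul 2
  have cu : Continuous u := continuous_iff_continuousAt.2 fun s => (du s).continuousAt
  have cv : Continuous v := continuous_iff_continuousAt.2 fun s => (dv s).continuousAt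
  have hXL : X L = X 0 := by
    have := hper 0
    rw [zero_add] at this
    simp only [hXdef, this]
  have hTper : Function.Periodic T L := hTdef ▸ hper.deriv
  have hAper : Function.Periodic A L := hAdef ▸ hTper.deriv
  have hTL : T L = T 0 := by simpa using hTper 0
  have hAL : A L = A 0 := by simpa using hAper 0
  obtain ⟨k, hk⟩ := exists_int_integral_arg_eq (L := L) du dv cu' cv' (fun s => (key s).1)
    (by simp only [hu, hXL, hAL]) (by simp only [hv, hXL, hTL, hAL])
  have hτ : torsionArc f = fun s => det3 (T s) (A s) (J s) / dot3 (A s) (A s) := by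
    funext s
    have hd : DifferentiableAt ℝ A s := (dA s).differentiableAt
    have := hκ s
    subst hJdef hAdef hTdef
    exact torsionArc_eq hd this
  have cτ : Continuous (torsionArc f) := by
    rw [hτ]
    exact (cT.continuous.det3 cA.continuous cJ).div (cA.continuous.dot3 cA.continuous)
      fun s => (hAA s).ne'
  have hτg : (fun s => torsionGen (fun t => inv3 P r (f t)) s *
      ‖deriv (fun t => inv3 P r (f t)) s‖) =
      fun s => -((u s * v' s - v s * u' s) / (u s ^ 2 + v s ^ 2)) - torsionArc f s := by
    funext s
    have hpos : 0 < h s := by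
      rw [hh]
      have := (hX0 s).lt_of_le' (by rw [dot3_self_eq_norm_sq]; positivity)
      positivity
    have hspeed : ‖deriv (fun t => inv3 P r (f t)) s‖ = h s := by
      have := (key s).2.2
      rw [dot3_self_eq_norm_sq] at this
      exact (pow_left_inj₀ (norm_nonneg _) hpos.le two_ne_zero).1 this
    rw [hspeed, torsionGen, hτ, ← (key s).2.1]
    ring
  have cq : Continuous fun s => (u s * v' s - v s * u' s) / (u s ^ 2 + v s ^ 2) :=
    ((cu.mul cv').sub (cv.mul cu')).div ((cu.pow 2).add (cv.pow 2)) fun s => (key s).1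
  refine ⟨-k, ?_⟩
  rw [totalTorsionGen, totalTorsionArc, hτg, intervalIntegral.integral_sub
    (cq.fun_neg.intervalIntegrable _ _) (cτ.intervalIntegrable _ _), intervalIntegral.integral_neg, hk]
  push_cast
  field_simp
  ring
end
end
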